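/- Assume that for all i = 1,…,n one has min(κ_i(u_{i+1}−u_i), κ_{i−1}(u_i−u_{i−1})) + 2d_i ≥ 0. Then there is at most one tuple of real numbers ξ₁ < ξ₂ < ⋯ < ξ_n satisfying the Stefan system: for each i = 1,…,n, d_i ξ_i/2 + k_i(u_{i+1}−u_i) F'(ξ_i/a_i)/(a_i (F(ξ_{i+1}/a_i) − F(ξ_i/a_i))) − k_{i−1}(u_i−u_{i−1}) F'(ξ_i/a_{i−1})/(a_{i−1} (F(ξ_i/a_{i−1}) − F(ξ_{i−1}/a_{i−1}))) = 0, where ξ₀ = −∞ and ξ_{n+1} = +∞. -/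

import Mathlib

open Real Filter Finset

/-- The rescaled Gaussian cumulative distribution function
`F(ξ) = (1/(2√π)) ∫_{-∞}^{ξ} e^{-s²/4} ds`. -/
noncomputable def F (x : ℝ) : ℝ :=
  (1 / (2 * Real.sqrt Real.pi)) * ∫ s in Set.Iio x, Real.exp (-s ^ 2 / 4)

/-- The derivative `F'(ξ) = (1/(2√π)) e^{-ξ²/4}`. -/
noncomputable def F' (x : ℝ) : ℝ :=
  (1 / (2 * Real.sqrt Real.pi)) * Real.exp (-x ^ 2 / 4)

/-- The functional
`E(ξ̄) = −Σ_{i=0}^{n} k_i(u_{i+1}−u_i) ln(F(ξ_{i+1}/a_i) − F(ξ_i/a_i)) + Σ_{i=1}^{n} d_i ξ_i²/4`,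
with the conventions `ξ₀ = −∞`, `ξ_{n+1} = +∞`, i.e. `F(ξ₀/a₀) = 0`, `F(ξ_{n+1}/a_n) = 1`.
Here `ξ : ℕ → ℝ`, only the values `ξ 1, …, ξ n` being relevant. -/
noncomputable def E (n : ℕ) (u a k d : ℕ → ℝ) (ξ : ℕ → ℝ) : ℝ :=
  -(∑ i ∈ Finset.range (n + 1), k i * (u (i + 1) - u i) *
      Real.log ((if i = n then 1 else F (ξ (i + 1) / a i)) -
        (if i = 0 then 0 else F (ξ i / a i))))
  + ∑ i ∈ Finset.Icc 1 n, d i * ξ i ^ 2 / 4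

/-- Reindexing of a point of `ℝⁿ` as the sequence `ξ_1, …, ξ_n` (paper indexing). -/
noncomputable def toSeq (n : ℕ) (x : EuclideanSpace ℝ (Fin n)) : ℕ → ℝ :=
  fun i => if h : i - 1 < n then x ⟨i - 1, h⟩ else 0

/-- The left-hand side of the `i`-th equation (`1 ≤ i ≤ n`) of the Stefan system:
`d_i ξ_i/2 + k_i(u_{i+1}−u_i) F'(ξ_i/a_i)/(a_i (F(ξ_{i+1}/a_i) − F(ξ_i/a_i)))
 − k_{i−1}(u_i−u_{i−1}) F'(ξ_i/a_{i−1})/(a_{i−1} (F(ξ_i/a_{i−1}) − F(ξ_{i−1}/a_{i−1})))`,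
with the conventions `ξ₀ = −∞` (so `F(ξ₀/a₀) = 0`) and `ξ_{n+1} = +∞` (so `F(ξ_{n+1}/a_n) = 1`). -/
noncomputable def stefanLHS (n : ℕ) (u a k d : ℕ → ℝ) (ξ : ℕ → ℝ) (i : ℕ) : ℝ :=
  d i * ξ i / 2
  + k i * (u (i + 1) - u i) * F' (ξ i / a i) /
      (a i * ((if i = n then 1 else F (ξ (i + 1) / a i)) - F (ξ i / a i)))
  - k (i - 1) * (u i - u (i - 1)) * F' (ξ i / a (i - 1)) /
      (a (i - 1) * (F (ξ i / a (i - 1)) - (if i = 1 then 0 else F (ξ (i - 1) / a (i - 1)))))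

lemma integrable_exp_neg_sq_div_four : MeasureTheory.Integrable fun s : ℝ => exp (-s ^ 2 / 4) := by
  refine (integrable_exp_neg_mul_sq (b := 1 / 4) (by norm_num)).congr (.of_forall fun s => ?_)
  dsimp only
  ring_nf

lemma integral_exp_neg_sq_div_four : ∫ s : ℝ, exp (-s ^ 2 / 4) = 2 * √π := by
  have h := integral_gaussian (1 / 4)
  have h4 : √(π / (1 / 4)) = 2 * √π := by
    rw [show π / (1 / 4) = 2 ^ 2 * π by ring, Real.sqrt_mul (by positivity),
      Real.sqrt_sq (by norm_num)]
  rw [h4] at h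
  rw [← h]
  congr 1
  ext s
  ring_nf

lemma F_eq_integral_Iic (x : ℝ) :
    F x = (1 / (2 * √π)) * ∫ s in Set.Iic x, exp (-s ^ 2 / 4) := by
  rw [F, MeasureTheory.integral_Iic_eq_integral_Iio]

lemma F'_pos (x : ℝ) : 0 < F' x := by
  have := Real.pi_pos
  unfold F'
  positivity

lemma F'_neg (x : ℝ) : F' (-x) = F' x := by
  simp [F']

lemma F_neg (x : ℝ) : F (-x) = 1 - F x := by
  have h := intervalIntegral.integral_Iic_add_Ioi (b := x)
    integrable_exp_neg_sq_div_four.integrableOn integrable_exp_neg_sq_div_four.integrableOn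
  have hn := integral_comp_neg_Iic (-x) fun s : ℝ => exp (-s ^ 2 / 4)
  simp only [neg_sq, neg_neg] at hn
  rw [integral_exp_neg_sq_div_four] at h
  have hpi : 0 < √π := Real.sqrt_pos.2 Real.pi_pos
  rw [F_eq_integral_Iic, F_eq_integral_Iic, hn, eq_sub_of_add_eq' h]
  field_simp

lemma hasDerivAt_F (x : ℝ) : HasDerivAt F (F' x) x := by
  have hF : F = fun y => F 0 + (1 / (2 * √π)) * ∫ s in (0 : ℝ)..y, exp (-s ^ 2 / 4) := by
    ext y
    rw [F_eq_integral_Iic, F_eq_integral_Iic, ← intervalIntegral.integral_Iic_sub_Iic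
      integrable_exp_neg_sq_div_four.integrableOn integrable_exp_neg_sq_div_four.integrableOn]
    ring
  rw [hF]
  have hc : Continuous fun s : ℝ => exp (-s ^ 2 / 4) := by fun_prop
  exact ((hc.integral_hasStrictDerivAt 0 x).hasDerivAt.const_mul _).const_add _

lemma hasDerivAt_F' (x : ℝ) : HasDerivAt F' (-(x / 2) * F' x) x := by
  have h : HasDerivAt (fun s : ℝ => -s ^ 2 / 4) (-(x / 2)) x := by
    refine (((hasDerivAt_id x).pow 2).neg.div_const 4).congr_deriv ?_
    simp
    ring
  refine (h.exp.const_mul (1 / (2 * √π))).congr_deriv ?_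
  simp only [F']
  ring

lemma F_strictMono : StrictMono F :=
  strictMono_of_hasDerivAt_pos hasDerivAt_F F'_pos

lemma tendsto_F_atTop : Tendsto F atTop (nhds 1) := by
  have h := MeasureTheory.intervalIntegral_tendsto_integral_Ioi 0
    integrable_exp_neg_sq_div_four.integrableOn tendsto_id
  have hF : ∀ y, F 0 + (1 / (2 * √π)) * ∫ s in (0 : ℝ)..y, exp (-s ^ 2 / 4) = F y := by
    intro y
    rw [F_eq_integral_Iic, F_eq_integral_Iic, ← intervalIntegral.integral_Iic_sub_Iic
      integrable_exp_neg_sq_div_four.integrableOn integrable_exp_neg_sq_div_four.integrableOn]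
    ring
  have h1 := intervalIntegral.integral_Iic_add_Ioi (b := (0 : ℝ))
    integrable_exp_neg_sq_div_four.integrableOn integrable_exp_neg_sq_div_four.integrableOn
  rw [integral_exp_neg_sq_div_four] at h1
  have hpi : 0 < √π := Real.sqrt_pos.2 Real.pi_pos
  refine ((h.const_mul (1 / (2 * √π))).const_add (F 0)).congr hF |>.trans_eq ?_
  rw [F_eq_integral_Iic, ← mul_add, h1]
  field_simp

lemma F_lt_one (x : ℝ) : F x < 1 :=
  (F_strictMono (lt_add_one x)).trans_le
    (F_strictMono.monotone.ge_of_tendsto tendsto_F_atTop (x + 1))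

lemma F_pos (x : ℝ) : 0 < F x := by
  linarith [F_neg x, F_lt_one (-x)]

lemma tendsto_F'_atTop : Tendsto F' atTop (nhds 0) := by
  have h : Tendsto (fun s : ℝ => -s ^ 2 / 4) atTop atBot := by
    have := (tendsto_pow_atTop (α := ℝ) two_ne_zero).atTop_div_const (show (0 : ℝ) < 4 by norm_num)
    refine (tendsto_neg_atTop_atBot.comp this).congr fun s => ?_
    simp
    ring
  have hF := (Real.tendsto_exp_atBot.comp h).const_mul (1 / (2 * √π))
  rw [mul_zero] at hF
  exact hF

lemma strictMonoOn_F'_excess (x : ℝ) :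
    StrictMonoOn (fun y => F' x - F' y - x / 2 * (F y - F x)) (Set.Ici x) := by
  have hd : ∀ y, HasDerivAt (fun y => F' x - F' y - x / 2 * (F y - F x))
      (F' y * ((y - x) / 2)) y := fun y =>
    (((hasDerivAt_F' y).const_sub (F' x)).sub
      (((hasDerivAt_F y).sub_const (F x)).const_mul (x / 2))).congr_deriv (by ring)
  refine strictMonoOn_of_deriv_pos (convex_Ici x)
    (fun y _ => (hd y).continuousAt.continuousWithinAt) fun y hy => ?_
  rw [interior_Ici, Set.mem_Ioi] at hy
  rw [(hd y).deriv]
  exact mul_pos (F'_pos y) (by linarith)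

lemma half_mul_F_sub_lt {x y : ℝ} (h : x < y) : x / 2 * (F y - F x) < F' x - F' y := by
  have := strictMonoOn_F'_excess x Set.self_mem_Ici h.le h
  simp only [sub_self, mul_zero] at this
  linarith

lemma half_mul_one_sub_F_lt (x : ℝ) : x / 2 * (1 - F x) < F' x := by
  have hm := strictMonoOn_F'_excess x
  have hlim : Tendsto (fun y => F' x - F' y - x / 2 * (F y - F x)) atTop
      (nhds (F' x - 0 - x / 2 * (1 - F x))) :=
    (tendsto_F'_atTop.const_sub _).sub ((tendsto_F_atTop.sub_const _).const_mul _)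
  have h1 : F' x - F' (x + 1) - x / 2 * (F (x + 1) - F x) ≤ F' x - 0 - x / 2 * (1 - F x) := by
    refine ge_of_tendsto hlim ((eventually_ge_atTop (x + 1)).mono fun y hy => ?_)
    exact hm.monotoneOn (by simp) (Set.mem_Ici.2 (by linarith)) hy
  linarith [half_mul_F_sub_lt (lt_add_one x)]

lemma F_sub_le {x y : ℝ} (hx : 0 ≤ x) (h : x ≤ y) : F y - F x ≤ F' x * (y - x) := by
  refine (convex_Ici x).image_sub_le_mul_sub_of_deriv_le
    (fun y _ => (hasDerivAt_F y).continuousAt.continuousWithinAt)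
    (fun y _ => (hasDerivAt_F y).differentiableAt.differentiableWithinAt) (fun y hy => ?_)
    x Set.self_mem_Ici y h h
  rw [interior_Ici, Set.mem_Ioi] at hy
  rw [(hasDerivAt_F y).deriv, F', F']
  gcongr

lemma sq_F_sub_div_four_le {x y : ℝ} (hx : 0 ≤ x) (h : x ≤ y) :
    (F y - F x) ^ 2 / 4 ≤ F' x * (F' x - F' y - x / 2 * (F y - F x)) := by
  have hd : ∀ y, HasDerivAt
      (fun y => F' x * (F' x - F' y - x / 2 * (F y - F x)) - (F y - F x) ^ 2 / 4)
      (F' y / 2 * (F' x * (y - x) - (F y - F x))) y := fun y =>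
    (((((hasDerivAt_F' y).const_sub (F' x)).sub
      (((hasDerivAt_F y).sub_const (F x)).const_mul (x / 2))).const_mul (F' x)).sub
      ((((hasDerivAt_F y).sub_const (F x)).pow 2).div_const 4)).congr_deriv (by
        push_cast
        ring)
  have hm := monotoneOn_of_deriv_nonneg (convex_Ici x)
    (fun y _ => (hd y).continuousAt.continuousWithinAt)
    (fun y _ => (hd y).differentiableAt.differentiableWithinAt) (fun y hy => by
      rw [interior_Ici, Set.mem_Ioi] at hy
      rw [(hd y).deriv]
      exact mul_nonneg (by linarith [F'_pos y]) (by linarith [F_sub_le hx hy.le]))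
    Set.self_mem_Ici h h
  simp only [sub_self, mul_zero] at hm
  linarith

lemma sq_one_sub_F_div_four_le {x : ℝ} (hx : 0 ≤ x) :
    (1 - F x) ^ 2 / 4 ≤ F' x * (F' x - x / 2 * (1 - F x)) := by
  have h1 : Tendsto (fun y => (F y - F x) ^ 2 / 4) atTop (nhds ((1 - F x) ^ 2 / 4)) :=
    ((tendsto_F_atTop.sub_const _).pow 2).div_const 4
  have h2 : Tendsto (fun y => F' x * (F' x - F' y - x / 2 * (F y - F x))) atTop
      (nhds (F' x * (F' x - 0 - x / 2 * (1 - F x)))) :=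
    ((tendsto_F'_atTop.const_sub _).sub
      ((tendsto_F_atTop.sub_const _).const_mul _)).const_mul _
  rw [sub_zero] at h2
  exact le_of_tendsto_of_tendsto h1 h2
    ((eventually_ge_atTop x).mono fun y hy => sq_F_sub_div_four_le hx hy)

/-- A strictly increasing function whose slope is at least `1/4` on the nonnegative half-line. -/
def SteepMono (P : ℝ → ℝ) : Prop :=
  StrictMono P ∧ ∀ s t, 0 ≤ s → s ≤ t → (t - s) / 4 ≤ P t - P s

lemma steepMono_F'_div {D q : ℝ → ℝ} (hD : ∀ s, HasDerivAt D (q s - F' s) s)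
    (hpos : ∀ s, 0 < D s) (hlt : ∀ s, s / 2 * D s < F' s - q s)
    (hsq : ∀ s, 0 ≤ s → D s ^ 2 / 4 ≤ F' s * (F' s - q s - s / 2 * D s)) :
    SteepMono fun s => F' s / D s := by
  have hd : ∀ s, HasDerivAt (fun s => F' s / D s)
      (F' s * (F' s - q s - s / 2 * D s) / D s ^ 2) s := fun s =>
    ((hasDerivAt_F' s).div (hD s) (hpos s).ne').congr_deriv (by ring)
  constructor
  · exact strictMono_of_hasDerivAt_pos hd fun s =>
      div_pos (mul_pos (F'_pos s) (by linarith [hlt s])) (pow_pos (hpos s) 2)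
  · intro s t hs hst
    have := (convex_Ici (0 : ℝ)).mul_sub_le_image_sub_of_le_deriv (C := 1 / 4)
      (fun y _ => (hd y).continuousAt.continuousWithinAt)
      (fun y _ => (hd y).differentiableAt.differentiableWithinAt) (fun y hy => by
        rw [interior_Ici, Set.mem_Ioi] at hy
        rw [(hd y).deriv, le_div_iff₀ (pow_pos (hpos y) 2)]
        linarith [hsq y hy.le])
      s hs t (hs.trans hst) hst
    linarith

lemma steepMono_F'_div_F_add_sub {c : ℝ} (hc : 0 < c) :
    SteepMono fun s => F' s / (F (s + c) - F s) := by
  refine steepMono_F'_div (q := fun s => F' (s + c)) (fun s => ?_) (fun s => ?_) (fun s => ?_)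
    fun s hs => ?_
  · exact ((hasDerivAt_F (s + c)).comp_add_const s c).sub (hasDerivAt_F s)
  · exact sub_pos.2 (F_strictMono (by linarith))
  · exact half_mul_F_sub_lt (by linarith)
  · exact sq_F_sub_div_four_le hs (by linarith)

lemma steepMono_F'_div_one_sub_F : SteepMono fun s => F' s / (1 - F s) := by
  refine steepMono_F'_div (q := fun _ => 0) (fun s => ?_) (fun s => ?_) (fun s => ?_)
    fun s hs => ?_
  · simpa using (hasDerivAt_F s).const_sub 1
  · exact sub_pos.2 (F_lt_one s)
  · simpa using half_mul_one_sub_F_lt s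
  · simpa using sq_one_sub_F_div_four_le hs

lemma SteepMono.strictMono_balance {P Q : ℝ → ℝ} (hP : SteepMono P) (hQ : SteepMono Q)
    {A B α β d : ℝ} (hA : 0 < A) (hB : 0 < B) (hα : 0 < α) (hβ : 0 < β)
    (hd : 0 ≤ min (A / α ^ 2) (B / β ^ 2) + 2 * d) :
    StrictMono fun s => d * s / 2 + A / α * P (s / α) - B / β * Q (-(s / β)) := by
  have hdA : 0 ≤ A / α ^ 2 + 2 * d := hd.trans (by gcongr; exact min_le_left _ _)
  have hdB : 0 ≤ B / β ^ 2 + 2 * d := hd.trans (by gcongr; exact min_le_right _ _)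
  refine StrictMonoOn.Iic_union_Ici (a := 0) ?_ ?_
  · intro s _ t ht hst
    have ht : t ≤ 0 := ht
    have h1 := mul_lt_mul_of_pos_left (hP.1 (div_lt_div_of_pos_right hst hα)) (div_pos hA hα)
    have h2 := mul_le_mul_of_nonneg_left (hQ.2 (-(t / β)) (-(s / β))
      (neg_nonneg.2 (div_nonpos_of_nonpos_of_nonneg ht hβ.le))
      (neg_le_neg (by gcongr))) (div_pos hB hβ).le
    have h3 := mul_nonneg hdB (sub_nonneg.2 hst.le)
    have h4 : B / β * ((-(s / β) - -(t / β)) / 4) = B / β ^ 2 * (t - s) / 4 := by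
      field_simp
      ring
    rw [h4] at h2
    dsimp only
    linarith
  · intro s hs t _ hst
    have hs : 0 ≤ s := hs
    have h1 := mul_lt_mul_of_pos_left
      (hQ.1 (neg_lt_neg (div_lt_div_of_pos_right hst hβ))) (div_pos hB hβ)
    have h2 := mul_le_mul_of_nonneg_left (hP.2 (s / α) (t / α) (by positivity)
      (by gcongr)) (div_pos hA hα).le
    have h3 := mul_nonneg hdA (sub_nonneg.2 hst.le)
    have h4 : A / α * ((t / α - s / α) / 4) = A / α ^ 2 * (t - s) / 4 := by
      field_simp
    rw [h4] at h2
    dsimp only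
    linarith

/-- If the gap to the right of a free boundary does not grow, then the flux on that side is bounded
below by a steep function of the boundary position which is exact at the initial one. -/
lemma exists_steepMono_right {p : Prop} [Decidable p] {α x y x' y' : ℝ} (hα : 0 < α)
    (hxy : ¬p → x < y) (hxy' : ¬p → x' < y') (hle : ¬p → y' - y ≤ x' - x) :
    ∃ P, SteepMono P ∧ P (x / α) = F' (x / α) / ((if p then 1 else F (y / α)) - F (x / α)) ∧
      P (x' / α) ≤ F' (x' / α) / ((if p then 1 else F (y' / α)) - F (x' / α)) := by
  by_cases hp : p
  · simp only [if_pos hp]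
    exact ⟨_, steepMono_F'_div_one_sub_F, rfl, le_rfl⟩
  · simp only [if_neg hp]
    have hc : 0 < (y - x) / α := div_pos (sub_pos.2 (hxy hp)) hα
    refine ⟨_, steepMono_F'_div_F_add_sub hc, ?_, ?_⟩
    · rw [← add_div, add_sub_cancel]
    · rw [← add_div]
      have h1 : F (x' / α) < F (y' / α) :=
        F_strictMono (div_lt_div_of_pos_right (hxy' hp) hα)
      have h2 : F (y' / α) ≤ F ((x' + (y - x)) / α) :=
        F_strictMono.monotone (div_le_div_of_nonneg_right (by linarith [hle hp]) hα.le)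
      exact div_le_div_of_nonneg_left (F'_pos _).le (by linarith) (by linarith)

/-- The left-hand version of `exists_steepMono_right`, obtained by reflection. -/
lemma exists_steepMono_left {p : Prop} [Decidable p] {α x y x' y' : ℝ} (hα : 0 < α)
    (hxy : ¬p → y < x) (hle : ¬p → y' - y ≤ x' - x) :
    ∃ Q, SteepMono Q ∧ Q (-(x / α)) = F' (x / α) / (F (x / α) - (if p then 0 else F (y / α))) ∧
      F' (x' / α) / (F (x' / α) - (if p then 0 else F (y' / α))) ≤ Q (-(x' / α)) := by
  by_cases hp : p
  · simp only [if_pos hp]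
    refine ⟨_, steepMono_F'_div_one_sub_F, ?_, ?_⟩ <;> simp [F'_neg, F_neg]
  · simp only [if_neg hp]
    have hc : 0 < (x - y) / α := div_pos (sub_pos.2 (hxy hp)) hα
    have hred : ∀ z, F (-(z / α) + (x - y) / α) - F (-(z / α)) =
        F (z / α) - F ((z - (x - y)) / α) := by
      intro z
      rw [show -(z / α) + (x - y) / α = -((z - (x - y)) / α) by ring, F_neg, F_neg]
      ring
    refine ⟨_, steepMono_F'_div_F_add_sub hc, ?_, ?_⟩
    · rw [hred, F'_neg, sub_sub_cancel]
    · rw [hred, F'_neg]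
      have h1 : F ((x' - (x - y)) / α) < F (x' / α) :=
        F_strictMono (div_lt_div_of_pos_right (by linarith [hxy hp]) hα)
      have h2 : F (y' / α) ≤ F ((x' - (x - y)) / α) :=
        F_strictMono.monotone (div_le_div_of_nonneg_right (by linarith [hle hp]) hα.le)
      exact div_le_div_of_nonneg_left (F'_pos _).le (by linarith) (by linarith)

/-- Comparison principle for the Stefan system. -/
lemma le_of_stefanLHS_eq_zero {n : ℕ} {u a k d : ℕ → ℝ}
    (hu : ∀ i ≤ n, u i < u (i + 1)) (ha : ∀ i ≤ n, 0 < a i) (hk : ∀ i ≤ n, 0 < k i)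
    (hconv : ∀ i, 1 ≤ i → i ≤ n →
      0 ≤ min (k i / a i ^ 2 * (u (i + 1) - u i))
            (k (i - 1) / a (i - 1) ^ 2 * (u i - u (i - 1))) + 2 * d i)
    {ξ η : ℕ → ℝ}
    (hξ : ∀ i, 1 ≤ i → i < n → ξ i < ξ (i + 1))
    (hξ0 : ∀ i, 1 ≤ i → i ≤ n → stefanLHS n u a k d ξ i = 0)
    (hη : ∀ i, 1 ≤ i → i < n → η i < η (i + 1))
    (hη0 : ∀ i, 1 ≤ i → i ≤ n → stefanLHS n u a k d η i = 0)
    {j : ℕ} (hj1 : 1 ≤ j) (hjn : j ≤ n) : η j ≤ ξ j := by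
  obtain ⟨i, hi, hmax⟩ := (Finset.Icc 1 n).exists_max_image (fun i => η i - ξ i)
    ⟨j, Finset.mem_Icc.2 ⟨hj1, hjn⟩⟩
  obtain ⟨hi1, hin⟩ := Finset.mem_Icc.1 hi
  have hmax' : ∀ l, 1 ≤ l → l ≤ n → η l - ξ l ≤ η i - ξ i := fun l h1 h2 =>
    hmax l (Finset.mem_Icc.2 ⟨h1, h2⟩)
  by_contra! hlt
  have hlt' : ξ i < η i := by linarith [hmax' j hj1 hjn]
  obtain ⟨m, rfl⟩ : ∃ m, i = m + 1 := ⟨i - 1, by omega⟩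
  have hmn : m ≤ n := by omega
  obtain ⟨P, hP, hPξ, hPη⟩ := exists_steepMono_right (p := m + 1 = n) (ha _ hin)
    (fun h => hξ _ hi1 (by omega)) (fun h => hη _ hi1 (by omega))
    (fun h => hmax' (m + 1 + 1) (by omega) (by omega))
  obtain ⟨Q, hQ, hQξ, hQη⟩ := exists_steepMono_left (p := m + 1 = 1) (ha m hmn)
    (fun h => hξ m (by omega) (by omega)) (fun h => hmax' m (by omega) (by omega))
  have hA : 0 < k (m + 1) * (u (m + 1 + 1) - u (m + 1)) :=
    mul_pos (hk _ hin) (sub_pos.2 (hu _ hin))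
  have hB : 0 < k m * (u (m + 1) - u m) := mul_pos (hk _ hmn) (sub_pos.2 (hu _ hmn))
  have hd := hconv _ hi1 hin
  rw [Nat.add_sub_cancel, div_mul_eq_mul_div, div_mul_eq_mul_div] at hd
  have hmono := hP.strictMono_balance hQ hA hB (ha _ hin) (ha _ hmn) hd hlt'
  have eξ := hξ0 _ hi1 hin
  have eη := hη0 _ hi1 hin
  simp only [stefanLHS, Nat.add_sub_cancel, mul_div_mul_comm] at eξ eη
  rw [← hPξ, ← hQξ] at eξ
  have h1 := mul_le_mul_of_nonneg_left hPη (div_pos hA (ha _ hin)).le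
  have h2 := mul_le_mul_of_nonneg_left hQη (div_pos hB (ha _ hmn)).le
  dsimp only at hmono
  linarith

/-- If `min(κ_i(u_{i+1}−u_i), κ_{i−1}(u_i−u_{i−1})) + 2d_i ≥ 0` for all `i = 1,…,n`, there is
at most one tuple `ξ₁ < ⋯ < ξ_n` satisfying the Stefan system. -/
theorem stmt16 (n : ℕ) (hn : 1 ≤ n) (u a k d : ℕ → ℝ)
    (hu : ∀ i ≤ n, u i < u (i + 1))
    (ha : ∀ i ≤ n, 0 < a i)
    (hk : ∀ i ≤ n, 0 < k i)
    (hconv : ∀ i, 1 ≤ i → i ≤ n →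
      0 ≤ min (k i / a i ^ 2 * (u (i + 1) - u i))
            (k (i - 1) / a (i - 1) ^ 2 * (u i - u (i - 1))) + 2 * d i) :
    ∀ ξ η : ℕ → ℝ,
      (∀ i, 1 ≤ i → i < n → ξ i < ξ (i + 1)) →
      (∀ i, 1 ≤ i → i ≤ n → stefanLHS n u a k d ξ i = 0) →
      (∀ i, 1 ≤ i → i < n → η i < η (i + 1)) →
      (∀ i, 1 ≤ i → i ≤ n → stefanLHS n u a k d η i = 0) →
      ∀ i, 1 ≤ i → i ≤ n → ξ i = η i := by
  intro ξ η hξ hξ0 hη hη0 i hi1 hin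
  exact le_antisymm (le_of_stefanLHS_eq_zero hu ha hk hconv hη hη0 hξ hξ0 hi1 hin)
    (le_of_stefanLHS_eq_zero hu ha hk hconv hξ hξ0 hη hη0 hi1 hin)
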